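/- arXiv:2512.18036 — 10 statements merged into one kernel-verified Lean document; each statement's English description precedes it below -/
import Mathlib

section
/- For every positive integer x, one has 2·⌊log₂ x⌋ + 1 ≤ (5 / log₂ 3) · log₂(1 + x/2), where log₂ denotes the real base-2 logarithm; moreover the ratio (2·⌊log₂ x⌋ + 1) / log₂(1 + x/2) attains its maximum value 5/log₂ 3 at x = 4. -/
theorem three_pow_le_one_add_two_pow_half_pow_five (k : ℕ) :
    (3 : ℝ) ^ (2 * k + 1) ≤ (1 + (2 : ℝ) ^ k / 2) ^ 5 := by
  rcases lt_or_ge k 2 with hk | hk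
  · interval_cases k <;> norm_num
  · induction k, hk using Nat.le_induction with
    | base => norm_num
    | succ k hk ih =>
      have h4 : (2 : ℝ) ^ 2 ≤ 2 ^ k := pow_le_pow_right₀ (by norm_num) hk
      calc (3 : ℝ) ^ (2 * (k + 1) + 1) = 9 * 3 ^ (2 * k + 1) := by ring
        _ ≤ (5 / 3) ^ 5 * (1 + (2 : ℝ) ^ k / 2) ^ 5 := by gcongr; norm_num
        _ = (5 / 3 * (1 + (2 : ℝ) ^ k / 2)) ^ 5 := by rw [mul_pow]
        _ ≤ (1 + (2 : ℝ) ^ (k + 1) / 2) ^ 5 := by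
          gcongr
          rw [pow_succ]
          linarith

/-- For every positive integer `x`, `2⌊log₂ x⌋ + 1 ≤ (5 / log₂ 3) · log₂ (1 + x/2)`;
moreover the ratio `(2⌊log₂ x⌋ + 1) / log₂ (1 + x/2)` attains its maximum `5 / log₂ 3`
at `x = 4`. -/
theorem G_le_C_logb_one_add_half
    : (∀ x : ℕ, 0 < x →
        ((2 * Nat.log 2 x + 1 : ℕ) : ℝ) ≤ (5 / Real.logb 2 3) * Real.logb 2 (1 + (x : ℝ) / 2)) ∧
      ((2 * Nat.log 2 4 + 1 : ℕ) : ℝ) / Real.logb 2 (1 + (4 : ℝ) / 2) = 5 / Real.logb 2 3 := by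
  refine ⟨fun x hx => ?_, ?_⟩
  · have hlog : 0 < Real.logb 2 3 := Real.logb_pos (by norm_num) (by norm_num)
    have hpow : (2 : ℝ) ^ Nat.log 2 x ≤ x := by
      exact_mod_cast Nat.pow_log_le_self 2 hx.ne'
    have hle : (3 : ℝ) ^ (2 * Nat.log 2 x + 1) ≤ (1 + (x : ℝ) / 2) ^ 5 :=
      (three_pow_le_one_add_two_pow_half_pow_five _).trans (by gcongr)
    have h := Real.logb_le_logb_of_le (b := 2) (by norm_num) (by positivity) hle
    rw [Real.logb_pow, Real.logb_pow] at h
    rw [div_mul_eq_mul_div, le_div_iff₀ hlog]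
    exact_mod_cast h
  · have h : Nat.log 2 4 = 2 := Nat.log_pow (b := 2) (by norm_num) 2
    rw [h]
    norm_num
end

section
/- For every integer l ≥ 1 and all positive integers x₁, …, x_l, the sum Σ_{i=1}^{l} G(x_i) satisfies Σ_{i=1}^{l} (2·⌊log₂ x_i⌋ + 1) ≤ (5 / log₂ 3) · log₂ d_l, where d_l is defined by the Stern–Brocot denominator recurrence. (Since 5/log₂ 3 ≤ 3.1547, this gives the warm-up upper bound of 3.1547·log₂ n comparisons for Compressed Stern–Brocot Tree Search on a fraction with denominator n = d_l.) -/
/-- The gain of one step of the search with quotient `2 ^ k`, doubled to stay in `ℕ`. -/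
theorem two_pow_five_mul_three_pow_le (k : ℕ) :
    2 ^ 5 * 3 ^ (2 * k + 1) ≤ (2 + 2 ^ k) ^ 5 := by
  rcases lt_or_ge k 2 with hk | hk
  · interval_cases k <;> norm_num
  · induction k, hk using Nat.le_induction with
    | base => norm_num
    | succ k hk ih =>
      have h4 : 2 ^ 2 ≤ 2 ^ k := Nat.pow_le_pow_right (by norm_num) hk
      have h5 : (5 * (2 + 2 ^ k)) ^ 5 ≤ (3 * (2 + 2 ^ (k + 1))) ^ 5 :=
        Nat.pow_le_pow_left (by rw [pow_succ]; omega) 5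
      rw [mul_pow, mul_pow] at h5
      have h9 : 3 ^ (2 * (k + 1) + 1) = 9 * 3 ^ (2 * k + 1) := by ring
      omega

/-- The cost of one step of the search is bounded by the growth of the denominator. -/
theorem two_pow_five_mul_three_pow_log_le {x : ℕ} (hx : 0 < x) :
    2 ^ 5 * 3 ^ (2 * Nat.log 2 x + 1) ≤ (2 + x) ^ 5 :=
  (two_pow_five_mul_three_pow_le _).trans <| by
    gcongr
    exact Nat.pow_log_le_self 2 hx.ne'

/-- The state of the recurrence stays in the cone `0 < m ≤ d ≤ 2 * m`, and the exponential of the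
accumulated cost is bounded by the fifth power of the denominator. -/
theorem stern_brocot_invariant
    (l : ℕ) (x : ℕ → ℕ) (hx : ∀ i, 1 ≤ i → i ≤ l → 0 < x i)
    (d m : ℕ → ℤ) (hd0 : d 0 = 1) (hm0 : m 0 = 1)
    (hd : ∀ i, 1 ≤ i → i ≤ l → d i = d (i - 1) + (x i : ℤ) * m (i - 1))
    (hm : ∀ i, 1 ≤ i → i ≤ l → m i = d (i - 1) + ((x i : ℤ) - 1) * m (i - 1))
    (n : ℕ) (hn : n ≤ l) :
    0 < m n ∧ m n ≤ d n ∧ d n ≤ 2 * m n ∧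
      3 ^ (∑ i ∈ Finset.Icc 1 n, (2 * Nat.log 2 (x i) + 1)) ≤ d n ^ 5 := by
  induction n with
  | zero => simp [hd0, hm0]
  | succ n ih =>
    obtain ⟨hpos, hmd, hdm, hpow⟩ := ih (by omega)
    have hdn := hd (n + 1) (by omega) hn
    have hmn := hm (n + 1) (by omega) hn
    have hxn := hx (n + 1) (by omega) hn
    rw [Nat.add_sub_cancel] at hdn hmn
    have hx1 : (1 : ℤ) ≤ x (n + 1) := by exact_mod_cast hxn
    have hxm : 0 ≤ ((x (n + 1) : ℤ) - 1) * m n := mul_nonneg (by linarith) hpos.le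
    refine ⟨by linarith, by linarith, by linarith, ?_⟩
    rw [Finset.sum_Icc_succ_top (by omega), pow_add]
    have hstep : (2 : ℤ) ^ 5 * 3 ^ (2 * Nat.log 2 (x (n + 1)) + 1) ≤ (2 + x (n + 1)) ^ 5 := by
      exact_mod_cast two_pow_five_mul_three_pow_log_le hxn
    have hgrow : d n * (2 + x (n + 1)) ≤ 2 * d (n + 1) := by
      rw [hdn]
      nlinarith
    have hd_nonneg : 0 ≤ d n := by linarith
    have hgrow5 : (d n * (2 + x (n + 1))) ^ 5 ≤ (2 * d (n + 1)) ^ 5 :=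
      pow_le_pow_left₀ (by positivity) hgrow 5
    have hmul := mul_le_mul hpow hstep (by positivity) (by positivity)
    rw [mul_pow, mul_pow] at hgrow5
    linarith

/-- Compressed Stern–Brocot tree search query bound:
`Σ_{i=1}^l (2⌊log₂ xᵢ⌋ + 1) ≤ (5 / Real.logb 2 3) · log₂ d_l`. -/
theorem stern_brocot_sum_G_le_warmup
    (l : ℕ) (hl : 1 ≤ l) (x : ℕ → ℕ) (hx : ∀ i, 1 ≤ i → i ≤ l → 0 < x i)
    (d m : ℕ → ℤ) (hd0 : d 0 = 1) (hm0 : m 0 = 1)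
    (hd : ∀ i, 1 ≤ i → i ≤ l → d i = d (i - 1) + (x i : ℤ) * m (i - 1))
    (hm : ∀ i, 1 ≤ i → i ≤ l → m i = d (i - 1) + ((x i : ℤ) - 1) * m (i - 1)) :
    ∑ i ∈ Finset.Icc 1 l, ((2 * Nat.log 2 (x i) + 1 : ℕ) : ℝ)
      ≤ (5 / Real.logb 2 3) * Real.logb 2 (d l) := by
  obtain ⟨-, -, -, hpow⟩ := stern_brocot_invariant l x hx d m hd0 hm0 hd hm l le_rfl
  rw [← Nat.cast_sum]
  set S := ∑ i ∈ Finset.Icc 1 l, (2 * Nat.log 2 (x i) + 1)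
  have hreal : (3 : ℝ) ^ S ≤ (d l : ℝ) ^ 5 := by exact_mod_cast hpow
  have hlog := Real.logb_le_logb_of_le (b := 2) (by norm_num) (by positivity) hreal
  rw [Real.logb_pow, Real.logb_pow] at hlog
  have h3 : 0 < Real.logb 2 3 := Real.logb_pos (by norm_num) (by norm_num)
  rw [div_mul_eq_mul_div, le_div_iff₀ h3]
  exact_mod_cast hlog
end

section
/- For every integer l ≥ 1 and all positive integers x₁, …, x_l, the sum Σ_{i=1}^{l} G(x_i) satisfies Σ_{i=1}^{l} (2·⌊log₂ x_i⌋ + 1) ≤ (10 / log₂ 13) · log₂ d_l, where d_l is defined by the Stern–Brocot denominator recurrence. (Since 10/log₂ 13 ≤ 2.7024, this is the two-segments-at-a-time upper bound of 2.7024·log₂ n comparisons for a fraction with denominator n = d_l.) -/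
lemma root_five_thirteen_lt {μ : ℝ} (h : μ ^ 5 = 13) : μ < 1.671 := by
  by_contra! hc
  have := pow_le_pow_left₀ (by norm_num) hc 5
  norm_num [h] at this

lemma two_mul_pow_le_succ_left {μ : ℝ} (h0 : 0 < μ) (h1 : μ < 1.671) {a b n : ℕ} (ha : 2 ≤ a)
    (h : 2 * μ ^ n ≤ (1 + 2 ^ a) * (1 + 2 ^ b) + 1) :
    2 * μ ^ (n + 1) ≤ (1 + 2 ^ (a + 1)) * (1 + 2 ^ b) + 1 := by
  have hu : (4 : ℝ) ≤ 2 ^ a := by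
    calc (4 : ℝ) = 2 ^ 2 := by norm_num
      _ ≤ 2 ^ a := pow_le_pow_right₀ (by norm_num) ha
  have hv : (1 : ℝ) ≤ 2 ^ b := one_le_pow₀ (by norm_num)
  rw [pow_succ, pow_succ (2 : ℝ) a]
  generalize (2 : ℝ) ^ a = u at *
  generalize (2 : ℝ) ^ b = v at *
  have hstep : 0.6 ≤ 1 + u * 2 - μ * (1 + u) := by nlinarith
  nlinarith [mul_le_mul_of_nonneg_right h h0.le, mul_le_mul_of_nonneg_right hstep (by linarith : 0 ≤ 1 + v)]

lemma two_mul_pow_le {μ : ℝ} (h0 : 0 < μ) (h : μ ^ 5 = 13) (a b : ℕ) :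
    2 * μ ^ (a + b + 1) ≤ (1 + 2 ^ a) * (1 + 2 ^ b) + 1 := by
  have h1 := root_five_thirteen_lt h
  have hp (n : ℕ) : μ ^ n ≤ 1.671 ^ n := pow_le_pow_left₀ h0.le h1.le n
  have small (b : ℕ) (hb : b ≤ 2) (a : ℕ) :
      2 * μ ^ (a + b + 1) ≤ (1 + 2 ^ a) * (1 + 2 ^ b) + 1 := by
    rcases le_total a 2 with ha | ha
    · have h2 := hp 2
      have h3 := hp 3
      have h4 := hp 4
      interval_cases a <;> interval_cases b <;> norm_num at * <;> linarith
    · induction a, ha using Nat.le_induction with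
      | base =>
        have h3 := hp 3
        have h4 := hp 4
        interval_cases b <;> norm_num at * <;> linarith
      | succ a ha ih =>
        have := two_mul_pow_le_succ_left h0 h1 ha ih
        rwa [show a + 1 + b + 1 = a + b + 1 + 1 by ring]
  rcases le_total b 2 with hb | hb
  · exact small b hb a
  · induction b, hb using Nat.le_induction with
    | base => exact small 2 le_rfl a
    | succ b hb ih =>
      rw [mul_comm (1 + 2 ^ a : ℝ)] at ih ⊢
      exact two_mul_pow_le_succ_left h0 h1 hb ih

lemma pow_two_mul_add_one_le {r : ℝ} (h0 : 0 < r) (h : r ^ 10 = 13) (a : ℕ) :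
    r ^ (2 * a + 1) ≤ 1 + 2 ^ a := by
  have h1 : r < 1.3 := by
    by_contra! hc
    have := pow_le_pow_left₀ (by norm_num) hc 10
    norm_num [h] at this
  have hμ : r ^ 2 < 1.671 := root_five_thirteen_lt (by rw [← pow_mul, h])
  have key : (1.3 : ℝ) * 1.671 ^ a ≤ 1 + 2 ^ a := by
    rcases le_total a 2 with ha | ha
    · interval_cases a <;> norm_num
    · induction a, ha using Nat.le_induction with
      | base => norm_num
      | succ a ha ih =>
        have hu : (2 : ℝ) ^ 2 ≤ 2 ^ a := pow_le_pow_right₀ (by norm_num) ha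
        rw [pow_succ, pow_succ]
        linarith
  calc r ^ (2 * a + 1) = r * (r ^ 2) ^ a := by rw [← pow_mul]; ring
    _ ≤ 1.3 * 1.671 ^ a := by gcongr
    _ ≤ _ := key

lemma two_pow_log_le_cast {x : ℕ} (hx : 0 < x) : (2 : ℝ) ^ Nat.log 2 x ≤ x := by
  exact_mod_cast Nat.pow_log_le_self 2 hx.ne'

/-- Two consecutive Stern–Brocot segments multiply the denominator by at least
`((1 + x) * (1 + y) + 1) / 2`. -/
lemma mul_pow_le_two_segments {r d m : ℝ} (h0 : 0 < r) (h : r ^ 10 = 13) (hd : 0 < d)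
    (hdm : d ≤ 2 * m) {x y : ℕ} (hx : 0 < x) (hy : 0 < y) :
    d * r ^ ((2 * Nat.log 2 x + 1) + (2 * Nat.log 2 y + 1)) ≤
      d + x * m + y * (d + (x - 1) * m) := by
  have key := two_mul_pow_le (pow_pos h0 2) (by rw [← pow_mul, h]) (Nat.log 2 x) (Nat.log 2 y)
  rw [← pow_mul, show 2 * (Nat.log 2 x + Nat.log 2 y + 1) =
    (2 * Nat.log 2 x + 1) + (2 * Nat.log 2 y + 1) by ring] at key
  have hle : (1 + (2 : ℝ) ^ Nat.log 2 x) * (1 + 2 ^ Nat.log 2 y) ≤ (1 + x) * (1 + y) := by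
    gcongr
    · exact two_pow_log_le_cast hx
    · exact two_pow_log_le_cast hy
  have hx1 : (1 : ℝ) ≤ x := by exact_mod_cast hx
  have hc : (0 : ℝ) ≤ x + (x - 1) * y := by
    have := mul_nonneg (sub_nonneg.2 hx1) (Nat.cast_nonneg (α := ℝ) y)
    linarith
  have h1 := mul_le_mul_of_nonneg_left (key.trans (by gcongr : _ ≤ (1 + (x : ℝ)) * (1 + y) + 1)) hd.le
  have h2 := mul_le_mul_of_nonneg_left hdm hc
  linarith

/-- Compressed Stern–Brocot tree search query bound:
`Σ_{i=1}^l (2⌊log₂ xᵢ⌋ + 1) ≤ (10 / Real.logb 2 13) · log₂ d_l`. -/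
theorem stern_brocot_sum_G_le_two_segments
    (l : ℕ) (hl : 1 ≤ l) (x : ℕ → ℕ) (hx : ∀ i, 1 ≤ i → i ≤ l → 0 < x i)
    (d m : ℕ → ℤ) (hd0 : d 0 = 1) (hm0 : m 0 = 1)
    (hd : ∀ i, 1 ≤ i → i ≤ l → d i = d (i - 1) + (x i : ℤ) * m (i - 1))
    (hm : ∀ i, 1 ≤ i → i ≤ l → m i = d (i - 1) + ((x i : ℤ) - 1) * m (i - 1)) :
    ∑ i ∈ Finset.Icc 1 l, ((2 * Nat.log 2 (x i) + 1 : ℕ) : ℝ)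
      ≤ (10 / Real.logb 2 13) * Real.logb 2 (d l) := by
  have inv : ∀ k ≤ l, 0 < m k ∧ m k ≤ d k ∧ d k ≤ 2 * m k := by
    intro k
    induction k with
    | zero => simp [hd0, hm0]
    | succ k ih =>
      intro hk
      obtain ⟨h1, h2, h3⟩ := ih (by omega)
      have hxk : (1 : ℤ) ≤ x (k + 1) := by exact_mod_cast hx (k + 1) (by omega) hk
      have e1 := hd (k + 1) (by omega) hk
      have e2 := hm (k + 1) (by omega) hk
      simp only [Nat.add_sub_cancel] at e1 e2
      have := mul_le_mul_of_nonneg_right hxk h1.le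
      refine ⟨?_, ?_, ?_⟩ <;> rw [e2] <;> linarith
  obtain ⟨r, hr0, hr⟩ : ∃ r : ℝ, 0 < r ∧ r ^ 10 = 13 :=
    ⟨(13 : ℝ) ^ ((10 : ℕ) : ℝ)⁻¹, by positivity,
      Real.rpow_inv_natCast_pow (by norm_num) (by norm_num)⟩
  have main : ∀ k ≤ l, r ^ (∑ i ∈ Finset.Icc 1 k, (2 * Nat.log 2 (x i) + 1)) ≤ (d k : ℝ) := by
    intro k
    induction k using Nat.twoStepInduction with
    | zero => simp [hd0]
    | one =>
      intro hk
      have e1 := hd 1 le_rfl hk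
      simp only [Nat.sub_self, hd0, hm0, mul_one] at e1
      rw [Finset.Icc_self, Finset.sum_singleton, e1]
      push_cast
      exact (pow_two_mul_add_one_le hr0 hr _).trans
        (by gcongr; exact two_pow_log_le_cast (hx 1 le_rfl hk))
    | more k ih _ =>
      intro hk
      obtain ⟨h1, h2, h3⟩ := inv k (by omega)
      have e1 := hd (k + 1) (by omega) (by omega)
      have e2 := hm (k + 1) (by omega) (by omega)
      have e3 := hd (k + 2) (by omega) hk
      simp only [Nat.add_sub_cancel, show k + 2 - 1 = k + 1 by omega] at e1 e2 e3
      rw [Finset.sum_Icc_succ_top (by omega), Finset.sum_Icc_succ_top (by omega), add_assoc,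
        pow_add, e3, e1, e2]
      push_cast
      exact (mul_le_mul_of_nonneg_right (ih (by omega)) (by positivity)).trans
        (mul_pow_le_two_segments hr0 hr (by exact_mod_cast h1.trans_le h2) (by exact_mod_cast h3)
          (hx (k + 1) (by omega) (by omega)) (hx (k + 2) (by omega) hk))
  have hlog := Real.logb_le_logb_of_le (b := 2) (by norm_num) (by positivity) (main l le_rfl)
  have h13 : 0 < Real.logb 2 13 := Real.logb_pos (by norm_num) (by norm_num)
  have hlr : Real.logb 2 13 = 10 * Real.logb 2 r := by
    rw [← hr, Real.logb_pow]; norm_num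
  rw [Real.logb_pow] at hlog
  rw [← Nat.cast_sum, div_mul_eq_mul_div, le_div_iff₀ h13, hlr]
  linarith
end

section
/- For every integer l ≥ 1 and all positive integers x₁, …, x_l, the sum Σ_{i=1}^{l} G(x_i) satisfies Σ_{i=1}^{l} (2·⌊log₂ x_i⌋ + 1) ≤ (16 / log₂ 73) · log₂ d_l, where d_l is defined by the Stern–Brocot denominator recurrence. (Since 16/log₂ 73 ≤ 2.5849 and d_l equals the denominator n of the searched rational, this is the core of Theorem 1: Compressed Stern–Brocot Tree Search identifies an unknown rational α ∈ (0,1) with denominator n using at most 2.5849·log₂ n comparison queries.) -/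
/-- The growth factor `131 / 100` per query stays below the two slopes that control one step. -/
theorem query_growth_le (k : ℕ) :
    (131 / 100 : ℝ) ^ (2 * k + 1) ≤ 2 ^ k + 1 / 3 ∧
      (131 / 100 : ℝ) ^ (2 * k + 1) ≤ 3 / 4 * 2 ^ k + 1 := by
  obtain hk | hk := lt_or_ge k 2
  · interval_cases k <;> norm_num
  have four_le : (4 : ℝ) ≤ 2 ^ k := by
    calc (4 : ℝ) = 2 ^ 2 := by norm_num
      _ ≤ 2 ^ k := pow_le_pow_right₀ (by norm_num) hk
  have key : (131 / 100 : ℝ) ^ (2 * k + 1) ≤ 3 / 4 * 2 ^ k + 1 := by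
    clear four_le
    induction k, hk using Nat.le_induction with
    | base => norm_num
    | succ k hk ih =>
      have four_le : (4 : ℝ) ≤ 2 ^ k := by
        calc (4 : ℝ) = 2 ^ 2 := by norm_num
          _ ≤ 2 ^ k := pow_le_pow_right₀ (by norm_num) hk
      rw [show 2 * (k + 1) + 1 = (2 * k + 1) + 2 by ring, pow_add, pow_succ (2 : ℝ) k]
      linarith
  exact ⟨by linarith, key⟩

/-- One step of the recurrence multiplies the potential `d + 2 m` by at least
`(131 / 100) ^ (2 ⌊log₂ x⌋ + 1)` on the cone `m ≤ d ≤ 2 m`. -/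
theorem query_growth_mul_potential_le {x : ℕ} (hx : 0 < x) {d m : ℝ}
    (hmd : m ≤ d) (hdm : d ≤ 2 * m) :
    (131 / 100 : ℝ) ^ (2 * Nat.log 2 x + 1) * (d + 2 * m)
      ≤ (d + x * m) + 2 * (d + (x - 1) * m) := by
  obtain ⟨h₁, h₂⟩ := query_growth_le (Nat.log 2 x)
  have hpow : (2 : ℝ) ^ Nat.log 2 x ≤ x := by exact_mod_cast Nat.pow_log_le_self 2 hx.ne'
  generalize (131 / 100 : ℝ) ^ (2 * Nat.log 2 x + 1) = A at *
  have e₁ : 0 ≤ (x + 1 / 3 - A) * (2 * m - d) :=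
    mul_nonneg (by linarith) (by linarith)
  have e₂ : 0 ≤ (3 / 4 * x + 1 - A) * (d - m) :=
    mul_nonneg (by linarith) (by linarith)
  linarith

/-- Compressed Stern–Brocot tree search query bound:
`Σ_{i=1}^l (2⌊log₂ xᵢ⌋ + 1) ≤ (16 / Real.logb 2 73) · log₂ d_l`. -/
theorem stern_brocot_sum_G_le_main
    (l : ℕ) (hl : 1 ≤ l) (x : ℕ → ℕ) (hx : ∀ i, 1 ≤ i → i ≤ l → 0 < x i)
    (d m : ℕ → ℤ) (hd0 : d 0 = 1) (hm0 : m 0 = 1)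
    (hd : ∀ i, 1 ≤ i → i ≤ l → d i = d (i - 1) + (x i : ℤ) * m (i - 1))
    (hm : ∀ i, 1 ≤ i → i ≤ l → m i = d (i - 1) + ((x i : ℤ) - 1) * m (i - 1)) :
    ∑ i ∈ Finset.Icc 1 l, ((2 * Nat.log 2 (x i) + 1 : ℕ) : ℝ)
      ≤ (16 / Real.logb 2 73) * Real.logb 2 (d l) := by
  have invariant : ∀ i ≤ l, (m i : ℝ) ≤ d i ∧ (d i : ℝ) ≤ 2 * m i ∧
      3 * (131 / 100 : ℝ) ^ (∑ j ∈ Finset.Icc 1 i, (2 * Nat.log 2 (x j) + 1))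
        ≤ d i + 2 * m i := by
    intro i
    induction i with
    | zero => intro _; norm_num [hd0, hm0]
    | succ i ih =>
      intro hi
      obtain ⟨hmd, hdm, hpot⟩ := ih (by omega)
      have hxi := hx (i + 1) (by omega) hi
      have hd' : (d (i + 1) : ℝ) = d i + x (i + 1) * m i := by
        exact_mod_cast hd (i + 1) (by omega) hi
      have hm' : (m (i + 1) : ℝ) = d i + (x (i + 1) - 1) * m i := by
        exact_mod_cast hm (i + 1) (by omega) hi
      have hx1 : (1 : ℝ) ≤ x (i + 1) := by exact_mod_cast hxi
      have hm_nonneg : (0 : ℝ) ≤ m i := by linarith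
      have hxm : (m i : ℝ) ≤ x (i + 1) * m i := le_mul_of_one_le_left hm_nonneg hx1
      refine ⟨by linarith, by linarith, ?_⟩
      rw [Finset.sum_Icc_succ_top (by omega), pow_add, hd', hm']
      refine le_trans ?_ (query_growth_mul_potential_le hxi hmd hdm)
      rw [← mul_assoc, mul_comm]
      exact mul_le_mul_of_nonneg_left hpot (by positivity)
  obtain ⟨hmd, -, hpot⟩ := invariant l le_rfl
  rw [← Nat.cast_sum]
  set Q := ∑ j ∈ Finset.Icc 1 l, (2 * Nat.log 2 (x j) + 1)
  have hQd : (131 / 100 : ℝ) ^ Q ≤ d l := by linarith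
  have hlog73 : 0 < Real.logb 2 73 := Real.logb_pos (by norm_num) (by norm_num)
  have hbase : Real.logb 2 73 ≤ 16 * Real.logb 2 (131 / 100) := by
    calc Real.logb 2 73 ≤ Real.logb 2 ((131 / 100) ^ 16) :=
          Real.logb_le_logb_of_le (by norm_num) (by norm_num) (by norm_num)
      _ = 16 * Real.logb 2 (131 / 100) := by rw [Real.logb_pow]; norm_num
  have hlogd : Q * Real.logb 2 (131 / 100) ≤ Real.logb 2 (d l) := by
    rw [← Real.logb_pow]
    exact Real.logb_le_logb_of_le (by norm_num) (by positivity) hQd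
  rw [div_mul_eq_mul_div, le_div_iff₀ hlog73]
  calc (Q : ℝ) * Real.logb 2 73 ≤ Q * (16 * Real.logb 2 (131 / 100)) :=
        mul_le_mul_of_nonneg_left hbase (by positivity)
    _ ≤ 16 * Real.logb 2 (d l) := by linarith
end

section
/- For all positive integers x₁ and x₂, one has (2·⌊log₂ x₁⌋ + 1) + (2·⌊log₂ x₂⌋ + 1) ≤ (16 / log₂ 73) · log₂(x₁·x₂ + x₁ + 1). (This is the base case l = 2 of the inductive proof of the 2.5849·log₂ n upper bound, since d₂ = x₁x₂ + x₁ + 1.) -/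
theorem pow_seventy_three_le_two_pow_add_two_pow_eight (s : ℕ) :
    73 ^ (s + 1) ≤ (2 ^ s + 2) ^ 8 := by
  rcases lt_or_ge s 4 with hs | hs
  · interval_cases s <;> norm_num
  · have h : 73 ^ (s + 1) ≤ (2 ^ s) ^ 8 := by
      induction s, hs using Nat.le_induction with
      | base => norm_num
      | succ n _ ih =>
        calc 73 ^ (n + 1 + 1) = 73 ^ (n + 1) * 73 := pow_succ _ _
          _ ≤ (2 ^ n) ^ 8 * 256 := Nat.mul_le_mul ih (by norm_num)
          _ = (2 ^ (n + 1)) ^ 8 := by ring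
    exact h.trans (Nat.pow_le_pow_left (Nat.le_add_right _ _) 8)

theorem two_pow_log_add_log_add_two_le {x y : ℕ} (hx : 0 < x) (hy : 0 < y) :
    2 ^ (Nat.log 2 x + Nat.log 2 y) + 2 ≤ x * y + x + 1 := by
  have h := Nat.mul_le_mul (Nat.pow_log_le_self 2 hx.ne') (Nat.pow_log_le_self 2 hy.ne')
  rw [pow_add]
  omega

/-- Base case `l = 2`:
`(2⌊log₂ x₁⌋ + 1) + (2⌊log₂ x₂⌋ + 1) ≤ (16 / log₂ 73) · log₂ (x₁x₂ + x₁ + 1)`. -/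
theorem base_case_two
    (x₁ x₂ : ℕ) (hx₁ : 0 < x₁) (hx₂ : 0 < x₂) :
    ((2 * Nat.log 2 x₁ + 1 : ℕ) : ℝ) + ((2 * Nat.log 2 x₂ + 1 : ℕ) : ℝ)
      ≤ (16 / Real.logb 2 73) *
          Real.logb 2 ((x₁ : ℝ) * (x₂ : ℝ) + (x₁ : ℝ) + 1) := by
  have hpow : (73 : ℝ) ^ (Nat.log 2 x₁ + Nat.log 2 x₂ + 1) ≤
      ((x₁ : ℝ) * (x₂ : ℝ) + (x₁ : ℝ) + 1) ^ 8 := by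
    exact_mod_cast (pow_seventy_three_le_two_pow_add_two_pow_eight _).trans
      (Nat.pow_le_pow_left (two_pow_log_add_log_add_two_le hx₁ hx₂) 8)
  have hlog := Real.logb_le_logb_of_le (b := 2) one_lt_two (by positivity) hpow
  rw [Real.logb_pow, Real.logb_pow] at hlog
  have h73 : 0 < Real.logb 2 73 := Real.logb_pos one_lt_two (by norm_num)
  rw [div_mul_eq_mul_div, le_div_iff₀ h73]
  push_cast at hlog ⊢
  linarith
end

section
/- For all positive integers x₁, x₂, x₃, one has (2·⌊log₂ x₁⌋ + 1) + (2·⌊log₂ x₂⌋ + 1) + (2·⌊log₂ x₃⌋ + 1) ≤ (16 / log₂ 73) · log₂(x₁x₂x₃ + x₁x₂ + x₁ + x₃ + 1). (This is the base case l = 3 of the inductive proof of the 2.5849·log₂ n upper bound, since d₃ = x₁x₂x₃ + x₁x₂ + x₁ + x₃ + 1.) -/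
theorem pow_seventy_three_le_two_pow_add_four_pow (s : ℕ) :
    73 ^ (2 * s + 3) ≤ (2 ^ s + 4) ^ 16 := by
  rcases lt_or_ge s 6 with hs | hs
  · interval_cases s <;> norm_num
  · have h : 73 ^ (2 * s + 3) ≤ (2 ^ s) ^ 16 := by
      induction s, hs using Nat.le_induction with
      | base => norm_num
      | succ k _ ih =>
        calc 73 ^ (2 * (k + 1) + 3) = 73 ^ (2 * k + 3) * 73 ^ 2 := by ring
          _ ≤ (2 ^ k) ^ 16 * 2 ^ 16 := Nat.mul_le_mul ih (by norm_num)
          _ = (2 ^ (k + 1)) ^ 16 := by ring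
    exact h.trans (Nat.pow_le_pow_left (Nat.le_add_right _ _) 16)

/-- Base case `l = 3`: for positive integers `x₁, x₂, x₃`,
`G(x₁) + G(x₂) + G(x₃) ≤ (16 / log₂ 73) · log₂ (x₁x₂x₃ + x₁x₂ + x₁ + x₃ + 1)`. -/
theorem base_case_three
    (x₁ x₂ x₃ : ℕ) (hx₁ : 0 < x₁) (hx₂ : 0 < x₂) (hx₃ : 0 < x₃) :
    ((2 * Nat.log 2 x₁ + 1 : ℕ) : ℝ) + ((2 * Nat.log 2 x₂ + 1 : ℕ) : ℝ)
        + ((2 * Nat.log 2 x₃ + 1 : ℕ) : ℝ)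
      ≤ (16 / Real.logb 2 73) *
          Real.logb 2 ((x₁ : ℝ) * x₂ * x₃ + (x₁ : ℝ) * x₂ + x₁ + x₃ + 1) := by
  set s := Nat.log 2 x₁ + Nat.log 2 x₂ + Nat.log 2 x₃ with hs
  have hprod : 2 ^ s ≤ x₁ * x₂ * x₃ := by
    rw [hs, pow_add, pow_add]
    exact Nat.mul_le_mul (Nat.mul_le_mul (Nat.pow_log_le_self 2 hx₁.ne')
      (Nat.pow_log_le_self 2 hx₂.ne')) (Nat.pow_log_le_self 2 hx₃.ne')
  have hle : 2 ^ s + 4 ≤ x₁ * x₂ * x₃ + x₁ * x₂ + x₁ + x₃ + 1 := by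
    have := Nat.mul_pos hx₁ hx₂
    lia
  have hpow : (73 : ℝ) ^ (2 * s + 3) ≤
      ((x₁ : ℝ) * x₂ * x₃ + (x₁ : ℝ) * x₂ + x₁ + x₃ + 1) ^ 16 := by
    exact_mod_cast (pow_seventy_three_le_two_pow_add_four_pow s).trans
      (Nat.pow_le_pow_left hle 16)
  have hlog := Real.logb_le_logb_of_le one_lt_two (by positivity) hpow
  rw [Real.logb_pow, Real.logb_pow] at hlog
  have hpos : 0 < Real.logb 2 73 := Real.logb_pos one_lt_two (by norm_num)
  rw [div_mul_eq_mul_div, le_div_iff₀ hpos]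
  rw [hs] at hlog
  push_cast at hlog ⊢
  linarith
end

section
/- For every integer l ≥ 4 and all positive integers x₁, …, x_l, the Stern–Brocot denominator sequence satisfies the real inequality d_l / d_{l−4} ≥ (1 + x_{l−3}/2)·(1 + x_{l−1} + x_l·x_{l−1}) + (1 + (x_{l−3} − 1)/2)·(x_{l−2} + x_{l−1}·x_{l−2} + x_l·x_{l−1}·x_{l−2} − x_{l−1} − x_l·x_{l−1} + x_l). -/
/-- The Stern–Brocot pair `(d, m)` satisfies `0 < m ≤ d ≤ 2 * m` throughout. -/
lemma stern_brocot_bounds {l : ℕ} {x : ℕ → ℕ} (hx : ∀ i, 1 ≤ i → i ≤ l → 0 < x i)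
    {d m : ℕ → ℤ} (hd0 : d 0 = 1) (hm0 : m 0 = 1)
    (hd : ∀ i, 1 ≤ i → i ≤ l → d i = d (i - 1) + (x i : ℤ) * m (i - 1))
    (hm : ∀ i, 1 ≤ i → i ≤ l → m i = d (i - 1) + ((x i : ℤ) - 1) * m (i - 1))
    {i : ℕ} (hi : i ≤ l) : 0 < m i ∧ m i ≤ d i ∧ d i ≤ 2 * m i := by
  induction i with
  | zero => simp [hd0, hm0]
  | succ k ih =>
    obtain ⟨hpos, hle, -⟩ := ih (by omega)
    have hxk : (1 : ℤ) ≤ x (k + 1) := by exact_mod_cast hx (k + 1) (by omega) hi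
    have hdk := hd (k + 1) (by omega) hi
    have hmk := hm (k + 1) (by omega) hi
    rw [Nat.add_sub_cancel] at hdk hmk
    have hmul := mul_nonneg (sub_nonneg.2 hxk) hpos.le
    refine ⟨?_, ?_, ?_⟩ <;> linarith


/-- Four-step lower bound on the growth of the Stern–Brocot denominators. -/
theorem stern_brocot_four_step_ratio
    (l : ℕ) (hl : 4 ≤ l) (x : ℕ → ℕ) (hx : ∀ i, 1 ≤ i → i ≤ l → 0 < x i)
    (d m : ℕ → ℤ) (hd0 : d 0 = 1) (hm0 : m 0 = 1)
    (hd : ∀ i, 1 ≤ i → i ≤ l → d i = d (i - 1) + (x i : ℤ) * m (i - 1))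
    (hm : ∀ i, 1 ≤ i → i ≤ l → m i = d (i - 1) + ((x i : ℤ) - 1) * m (i - 1)) :
    (d l : ℝ) / (d (l - 4) : ℝ)
      ≥ (1 + (x (l - 3) : ℝ) / 2)
            * (1 + (x (l - 1) : ℝ) + (x l : ℝ) * (x (l - 1) : ℝ))
        + (1 + ((x (l - 3) : ℝ) - 1) / 2)
            * ((x (l - 2) : ℝ) + (x (l - 1) : ℝ) * (x (l - 2) : ℝ)
                + (x l : ℝ) * (x (l - 1) : ℝ) * (x (l - 2) : ℝ)
                - (x (l - 1) : ℝ) - (x l : ℝ) * (x (l - 1) : ℝ) + (x l : ℝ)) := by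
  obtain ⟨k, rfl⟩ := Nat.exists_eq_add_of_le' hl
  obtain ⟨hpos, hle, htwo⟩ :=
    stern_brocot_bounds hx hd0 hm0 hd hm (show k ≤ k + 4 by omega)
  have hd1 := hd (k + 1) (by omega) (by omega)
  have hd2 := hd (k + 2) (by omega) (by omega)
  have hd3 := hd (k + 3) (by omega) (by omega)
  have hd4 := hd (k + 4) (by omega) (by omega)
  have hm1 := hm (k + 1) (by omega) (by omega)
  have hm2 := hm (k + 2) (by omega) (by omega)
  have hm3 := hm (k + 3) (by omega) (by omega)
  have ha : (1 : ℝ) ≤ x (k + 1) := by exact_mod_cast hx (k + 1) (by omega) (by omega)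
  have hb : (1 : ℝ) ≤ x (k + 2) := by exact_mod_cast hx (k + 2) (by omega) (by omega)
  simp only [Nat.reduceSubDiff, Nat.add_sub_cancel, Nat.add_one_sub_one]
    at hd1 hd2 hd3 hd4 hm1 hm2 hm3 ⊢
  have hdpos : (0 : ℝ) < d k := by exact_mod_cast hpos.trans_le hle
  have hhalf : (d k : ℝ) ≤ 2 * m k := by exact_mod_cast htwo
  rw [hd4, hd3, hm3, hd2, hm2, hd1, hm1, ge_iff_le, le_div_iff₀ hdpos]
  push_cast
  have hc : (0 : ℝ) ≤ x (k + 3) := Nat.cast_nonneg _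
  have he : (0 : ℝ) ≤ x (k + 4) := Nat.cast_nonneg _
  generalize (x (k + 1) : ℝ) = a at *
  generalize (x (k + 2) : ℝ) = b at *
  generalize (x (k + 3) : ℝ) = c at *
  generalize (x (k + 4) : ℝ) = e at *
  have hcoeff : 0 ≤ b + c * b + e * c * b - c - e * c + e := by
    have := mul_nonneg (sub_nonneg.2 hb) (add_nonneg hc (mul_nonneg he hc))
    linarith
  have hD : (1 + a / 2) * d k ≤ d k + a * m k := by
    linarith [mul_le_mul_of_nonneg_left hhalf (zero_le_one.trans ha)]
  have hM : (1 + (a - 1) / 2) * d k ≤ d k + (a - 1) * m k := by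
    linarith [mul_le_mul_of_nonneg_left hhalf (sub_nonneg.2 ha)]
  have hcoeff' : 0 ≤ 1 + c + e * c := by positivity
  linarith [mul_le_mul_of_nonneg_right hD hcoeff', mul_le_mul_of_nonneg_right hM hcoeff]
end

section
/- For all positive integers w, x, y, z, one has (2·⌊log₂ w⌋ + 1) + (2·⌊log₂ x⌋ + 1) + (2·⌊log₂ y⌋ + 1) + (2·⌊log₂ z⌋ + 1) ≤ (16 / log₂ 73) · log₂(1 + z/2 + y/2 + x/2 + w/2 + z·y/2 + y·x/2 + x·w/2 + z·w/2 + z·y·x/2 + y·x·w/2 + z·y·x·w/2), with equality at (w, x, y, z) = (4, 2, 2, 4), where the argument of the logarithm equals 73 and both sides equal 16. (This is the key four-variable inequality in the inductive step of the 2.5849·log₂ n upper bound; here w, x, y, z play the roles of x_{l−3}, x_{l−2}, x_{l−1}, x_l.) -/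
/-- Twice the argument of the logarithm in the four-variable inequality. -/
def twiceArg (w x y z : ℕ) : ℕ :=
  2 + z + y + x + w + z * y + y * x + x * w + z * w + z * y * x + y * x * w + z * y * x * w

theorem twiceArg_mono {w x y z w₁ x₁ y₁ z₁ : ℕ} (hw : w ≤ w₁) (hx : x ≤ x₁) (hy : y ≤ y₁)
    (hz : z ≤ z₁) : twiceArg w x y z ≤ twiceArg w₁ x₁ y₁ z₁ := by
  unfold twiceArg
  gcongr

theorem pow_le_twiceArg_of_lt :
    ∀ a < 12, ∀ b < 12 - a, ∀ c < 12 - a - b, ∀ d < 12 - a - b - c,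
      73 ^ (a + b + c + d + 2) * 2 ^ 8 ≤ twiceArg (2 ^ a) (2 ^ b) (2 ^ c) (2 ^ d) ^ 8 := by
  decide +kernel

theorem pow_73_mul_le_two_pow {s : ℕ} (hs : 12 ≤ s) : 73 ^ (s + 2) * 2 ^ 8 ≤ (2 ^ s) ^ 8 := by
  induction s, hs using Nat.le_induction with
  | base => norm_num
  | succ n _ ih =>
    rw [pow_succ 2 n, mul_pow, show n + 1 + 2 = (n + 2) + 1 by ring, pow_succ 73 (n + 2)]
    linarith [Nat.zero_le ((2 ^ n) ^ 8)]

theorem pow_le_twiceArg_two_pow (a b c d : ℕ) :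
    73 ^ (a + b + c + d + 2) * 2 ^ 8 ≤ twiceArg (2 ^ a) (2 ^ b) (2 ^ c) (2 ^ d) ^ 8 := by
  by_cases h : a + b + c + d < 12
  · exact pow_le_twiceArg_of_lt a (by omega) b (by omega) c (by omega) d (by omega)
  · refine (pow_73_mul_le_two_pow (not_lt.mp h)).trans (Nat.pow_le_pow_left ?_ 8)
    calc 2 ^ (a + b + c + d) = 2 ^ d * 2 ^ c * 2 ^ b * 2 ^ a := by ring
      _ ≤ twiceArg (2 ^ a) (2 ^ b) (2 ^ c) (2 ^ d) := Nat.le_add_left _ _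

theorem pow_log_le_twiceArg {w x y z : ℕ} (hw : 0 < w) (hx : 0 < x) (hy : 0 < y) (hz : 0 < z) :
    73 ^ (Nat.log 2 w + Nat.log 2 x + Nat.log 2 y + Nat.log 2 z + 2) * 2 ^ 8
      ≤ twiceArg w x y z ^ 8 :=
  (pow_le_twiceArg_two_pow _ _ _ _).trans <| Nat.pow_le_pow_left
    (twiceArg_mono (Nat.pow_log_le_self 2 hw.ne') (Nat.pow_log_le_self 2 hx.ne')
      (Nat.pow_log_le_self 2 hy.ne') (Nat.pow_log_le_self 2 hz.ne')) 8

theorem le_div_logb_mul_logb {s q : ℕ} (h : 73 ^ (s + 2) * 2 ^ 8 ≤ q ^ 8) :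
    2 * (s : ℝ) + 4 ≤ 16 / Real.logb 2 73 * Real.logb 2 ((q : ℝ) / 2) := by
  have hpow : (73 : ℝ) ^ (s + 2) ≤ ((q : ℝ) / 2) ^ 8 := by
    rw [div_pow, le_div_iff₀ (by positivity)]
    exact_mod_cast h
  have hlog := Real.logb_le_logb_of_le (b := 2) (by norm_num) (by positivity) hpow
  rw [Real.logb_pow, Real.logb_pow] at hlog
  have hpos : 0 < Real.logb 2 73 := Real.logb_pos (by norm_num) (by norm_num)
  rw [div_mul_eq_mul_div, le_div_iff₀ hpos]
  push_cast at hlog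
  linarith

/-- Key four-variable inequality in the inductive step of the `2.5849 log₂ n` upper bound,
with equality at `(w, x, y, z) = (4, 2, 2, 4)` where the argument of the logarithm is `73`
and both sides equal `16`. -/
theorem four_variable_inequality :
    (∀ w x y z : ℕ, 0 < w → 0 < x → 0 < y → 0 < z →
        ((2 * Nat.log 2 w + 1 : ℕ) : ℝ) + ((2 * Nat.log 2 x + 1 : ℕ) : ℝ)
          + ((2 * Nat.log 2 y + 1 : ℕ) : ℝ) + ((2 * Nat.log 2 z + 1 : ℕ) : ℝ)
        ≤ (16 / Real.logb 2 73) *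
            Real.logb 2
              (1 + (z : ℝ) / 2 + (y : ℝ) / 2 + (x : ℝ) / 2 + (w : ℝ) / 2
                + (z : ℝ) * y / 2 + (y : ℝ) * x / 2 + (x : ℝ) * w / 2 + (z : ℝ) * w / 2
                + (z : ℝ) * y * x / 2 + (y : ℝ) * x * w / 2 + (z : ℝ) * y * x * w / 2)) ∧
    (1 + (4 : ℝ) / 2 + (2 : ℝ) / 2 + (2 : ℝ) / 2 + (4 : ℝ) / 2
        + (4 : ℝ) * 2 / 2 + (2 : ℝ) * 2 / 2 + (2 : ℝ) * 4 / 2 + (4 : ℝ) * 4 / 2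
        + (4 : ℝ) * 2 * 2 / 2 + (2 : ℝ) * 2 * 4 / 2 + (4 : ℝ) * 2 * 2 * 4 / 2 = 73) ∧
    ((2 * Nat.log 2 4 + 1 : ℕ) : ℝ) + ((2 * Nat.log 2 2 + 1 : ℕ) : ℝ)
        + ((2 * Nat.log 2 2 + 1 : ℕ) : ℝ) + ((2 * Nat.log 2 4 + 1 : ℕ) : ℝ) = 16 ∧
    (16 / Real.logb 2 73) * Real.logb 2 73 = 16 := by
  refine ⟨fun w x y z hw hx hy hz => ?_, by norm_num, ?_, ?_⟩
  · have h := le_div_logb_mul_logb (pow_log_le_twiceArg hw hx hy hz)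
    convert h using 1
    · push_cast
      ring
    · congr 2
      simp only [twiceArg]
      push_cast
      ring
  · have h4 : Nat.log 2 4 = 2 := Nat.log_pow one_lt_two 2
    have h2 : Nat.log 2 2 = 1 := Nat.log_pow one_lt_two 1
    rw [h4, h2]
    norm_num
  · exact div_mul_cancel₀ _ (Real.logb_pos (by norm_num) (by norm_num)).ne'
end

section
/- Let a and b be real numbers with a ≥ 1 and b ≥ 1, and define φ_a = (2 − 2b/a + ab + √(4ab + a²b²)) / (2·(1 + b − b/a)) and φ_b = (2 − 2a/b + ab + √(4ab + a²b²)) / (2·(1 + a − a/b)). Then φ_a > 0, φ_b > 0, and they solve the fixed-point system φ_a = 1 + a − a/b + (a/b)·φ_b⁻¹ and φ_b = 1 + b − b/a + (b/a)·φ_a⁻¹ describing the limiting growth ratios of the Stern–Brocot denominators along the alternating path (L^a R^b)^k. -/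
/-- The common square root dominates `a * b`, so the numerator of the ratio is positive, and so
is its denominator. -/
lemma phi_numerator_denominator_pos {a b : ℝ} (ha : 1 ≤ a) (hb : 1 ≤ b) :
    0 < 2 - 2 * b / a + a * b + Real.sqrt (4 * a * b + a ^ 2 * b ^ 2) ∧ 0 < 1 + b - b / a := by
  have hb0 : 0 < b := by linarith
  have hdiv : b / a ≤ b := div_le_self hb0.le ha
  have hle : b ≤ a * b := le_mul_of_one_le_left hb0.le ha
  have hsqrt : a * b ≤ Real.sqrt (4 * a * b + a ^ 2 * b ^ 2) :=
    Real.le_sqrt_of_sq_le (by nlinarith)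
  rw [mul_div_assoc]
  constructor <;> linarith

/-- The product of the two limiting ratios. -/
lemma phi_mul_phi {a b : ℝ} (ha : 1 ≤ a) (hb : 1 ≤ b) :
    (2 - 2 * b / a + a * b + Real.sqrt (4 * a * b + a ^ 2 * b ^ 2)) / (2 * (1 + b - b / a)) *
      ((2 - 2 * a / b + a * b + Real.sqrt (4 * a * b + a ^ 2 * b ^ 2)) /
        (2 * (1 + a - a / b))) =
      (2 + a * b + Real.sqrt (4 * a * b + a ^ 2 * b ^ 2)) / 2 := by
  have ha0 : 0 < a := by linarith
  have hb0 : 0 < b := by linarith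
  have hB := (phi_numerator_denominator_pos ha hb).2
  have hA := (phi_numerator_denominator_pos hb ha).2
  have hS := Real.sq_sqrt (show 0 ≤ 4 * a * b + a ^ 2 * b ^ 2 by positivity)
  set S := Real.sqrt (4 * a * b + a ^ 2 * b ^ 2)
  have hqr : b / a * (a / b) = 1 := by field_simp
  have hqa : b / a * a = b := by field_simp
  have hrb : a / b * b = a := by field_simp
  rw [mul_div_assoc, mul_div_assoc, div_mul_div_comm, div_eq_div_iff (by positivity) two_ne_zero]
  generalize b / a = q at *
  generalize a / b = r at *
  have hAB : (1 + b - q) * (1 + a - r) = 2 + a * b - q - r := by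
    linear_combination hqr - hqa - hrb
  linear_combination 2 * hS + 8 * hqr - 4 * (2 + a * b + S) * hAB


/-- The limiting growth ratios `φ_a, φ_b` of Stern–Brocot denominators along the
alternating path `(L^a R^b)^k` are positive and solve the fixed-point system
`φ_a = 1 + a − a/b + (a/b) φ_b⁻¹` and `φ_b = 1 + b − b/a + (b/a) φ_a⁻¹`. -/
theorem phi_fixed_point_system
    (a b : ℝ) (ha : 1 ≤ a) (hb : 1 ≤ b) (φa φb : ℝ)
    (hφa : φa = (2 - 2 * b / a + a * b + Real.sqrt (4 * a * b + a ^ 2 * b ^ 2))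
                  / (2 * (1 + b - b / a)))
    (hφb : φb = (2 - 2 * a / b + a * b + Real.sqrt (4 * a * b + a ^ 2 * b ^ 2))
                  / (2 * (1 + a - a / b))) :
    φa > 0 ∧ φb > 0 ∧
      φa = 1 + a - a / b + (a / b) * φb⁻¹ ∧
      φb = 1 + b - b / a + (b / a) * φa⁻¹ := by
  obtain ⟨hNa, hB⟩ := phi_numerator_denominator_pos ha hb
  obtain ⟨hNb, hA⟩ := phi_numerator_denominator_pos hb ha
  rw [show 4 * b * a + b ^ 2 * a ^ 2 = 4 * a * b + a ^ 2 * b ^ 2 by ring, mul_comm b a] at hNb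
  have hmul := phi_mul_phi ha hb
  rw [← hφa, ← hφb] at hmul
  have hpa : 0 < φa := hφa ▸ div_pos hNa (by positivity)
  have hpb : 0 < φb := hφb ▸ div_pos hNb (by positivity)
  rw [eq_div_iff (by positivity), mul_div_assoc] at hφa hφb
  refine ⟨hpa, hpb, ?_, ?_⟩
  · rw [← div_eq_mul_inv, ← sub_eq_iff_eq_add', eq_div_iff hpb.ne']
    linear_combination hmul - hφb / 2
  · rw [← div_eq_mul_inv, ← sub_eq_iff_eq_add', eq_div_iff hpa.ne']
    linear_combination hmul - hφa / 2
end

section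
/- For a = 8 and b = 1, the limiting growth ratios φ_a = (2 − 2/8 + 8 + √96) / (2·(2 − 1/8)) and φ_b = (2 − 16 + 8 + √96) / 2 satisfy φ_a·φ_b = 5 + 2√6, and consequently the per-level query cost of the alternating path (L⁸R¹)^k satisfies (G(8) + G(1)) / log₂(φ_a·φ_b) = 8 / log₂(5 + 2√6) > 2.4189. (Hence searching for fractions of the form (L⁸R)^k requires at least 2.4189·log₂ n comparisons, where n is the denominator.) -/
set_option exponentiation.threshold 2000 in
/-- The rational approximation `1862 / 563` bounds `log₂ (5 + 2√6)` from above. -/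
theorem logb_two_five_add_two_sqrt_six_lt :
    Real.logb 2 (5 + 2 * Real.sqrt 6) < 1862 / 563 := by
  have hsqrt : Real.sqrt 6 < 2.44949 :=
    (Real.sqrt_lt' (by norm_num)).2 (by norm_num)
  have hx : 5 + 2 * Real.sqrt 6 < 9.89898 := by linarith
  have hpow : (5 + 2 * Real.sqrt 6) ^ 563 < (2 : ℝ) ^ 1862 :=
    (pow_lt_pow_left₀ hx (by positivity) (by norm_num)).trans (by norm_num)
  have hlog := Real.logb_lt_logb (b := 2) (by norm_num) (by positivity) hpow
  rw [Real.logb_pow, Real.logb_pow, Real.logb_self_eq_one (by norm_num)] at hlog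
  push_cast at hlog
  linarith


/-- Lower bound instance `a = 8`, `b = 1`: the limiting growth ratios satisfy
`φ_a · φ_b = 5 + 2√6`, and the per-level query cost of the path `(L⁸R)^k` is
`(G 8 + G 1) / log₂ (φ_a φ_b) = 8 / log₂ (5 + 2√6) > 2.4189`. -/
theorem lower_bound_instance
    (φa φb : ℝ)
    (hφa : φa = (2 - 2 / 8 + 8 + Real.sqrt 96) / (2 * (2 - 1 / 8)))
    (hφb : φb = (2 - 16 + 8 + Real.sqrt 96) / 2) :
    φa * φb = 5 + 2 * Real.sqrt 6 ∧
    (((2 * Nat.log 2 8 + 1 : ℕ) : ℝ) + ((2 * Nat.log 2 1 + 1 : ℕ) : ℝ))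
        / Real.logb 2 (φa * φb) = 8 / Real.logb 2 (5 + 2 * Real.sqrt 6) ∧
    8 / Real.logb 2 (5 + 2 * Real.sqrt 6) > 2.4189 := by 
  have hs : Real.sqrt 6 ^ 2 = 6 := Real.sq_sqrt (by norm_num)
  have h96 : Real.sqrt 96 = 4 * Real.sqrt 6 := by
    rw [show (96 : ℝ) = 4 ^ 2 * 6 by norm_num, Real.sqrt_mul (by norm_num),
      Real.sqrt_sq (by norm_num)]
  have hprod : φa * φb = 5 + 2 * Real.sqrt 6 := by
    rw [hφa, hφb, h96]
    linear_combination (32 / 15) * hs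
  refine ⟨hprod, ?_, ?_⟩
  · rw [hprod, show Nat.log 2 8 = 3 from Nat.log_pow (b := 2) (by norm_num) 3,
      Nat.log_one_right]
    norm_num
  · have hpos : 0 < Real.logb 2 (5 + 2 * Real.sqrt 6) :=
      Real.logb_pos (by norm_num) (by linarith [Real.sqrt_nonneg 6])
    have hlog := logb_two_five_add_two_sqrt_six_lt
    rw [gt_iff_lt, lt_div_iff₀ hpos]
    linarith
end
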